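/- In a matching market in which all choice functions are path-independent and cardinal monotone, let μ1, μ1', μ2, μ2' be stable matchings such that μ1' is an immediate predecessor of μ1 and μ2' is an immediate predecessor of μ2 in (S, ⪰). Then P(μ1) \ P(μ1') = P(μ2) \ P(μ2') if and only if ρ(μ1', μ1) = ρ(μ2', μ2), i.e., ρ⁺(μ1', μ1) = ρ⁺(μ2', μ2) and ρ⁻(μ1', μ1) = ρ⁻(μ2', μ2). -/

import Mathlib

/-- A matching market: finite disjoint sets of firms `F` and workers `W`; each firm `f`
has a set `accF f ⊆ W` of acceptable workers and a choice function `Cf f` on subsets of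
`accF f`; each worker `w` has a set `accW w ⊆ F` and a choice function `Cw w`, where
`f ∈ accW w ↔ w ∈ accF f`. -/
structure Market (F W : Type*) [Fintype F] [Fintype W] [DecidableEq F] [DecidableEq W] where
  accF : F → Finset W
  accW : W → Finset F
  compat : ∀ f w, f ∈ accW w ↔ w ∈ accF f
  Cf : F → Finset W → Finset W
  Cw : W → Finset F → Finset F
  CfSub : ∀ f S, Cf f S ⊆ S
  CwSub : ∀ w S, Cw w S ⊆ S

namespace Market

variable {F W : Type*} [Fintype F] [Fintype W] [DecidableEq F] [DecidableEq W]

/-- The set `μ(w)` of firms matched to worker `w` under the matching `μ`. -/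
def mw (M : Market F W) (μ : F → Finset W) (w : W) : Finset F :=
  Finset.univ.filter (fun f => w ∈ μ f)

/-- `μ` is a matching: each firm is matched to acceptable workers. -/
def IsMatching (M : Market F W) (μ : F → Finset W) : Prop :=
  ∀ f, μ f ⊆ M.accF f

/-- `μ` is individually rational. -/
def IndRational (M : Market F W) (μ : F → Finset W) : Prop :=
  (∀ f, M.Cf f (μ f) = μ f) ∧ (∀ w, M.Cw w (M.mw μ w) = M.mw μ w)

/-- The acceptable pair `(f, w)` blocks `μ`. -/
def Blocks (M : Market F W) (μ : F → Finset W) (f : F) (w : W) : Prop :=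
  w ∈ M.accF f ∧ w ∉ μ f ∧
    w ∈ M.Cf f (insert w (μ f)) ∧ f ∈ M.Cw w (insert f (M.mw μ w))

/-- `μ` is a stable matching. -/
def Stable (M : Market F W) (μ : F → Finset W) : Prop :=
  M.IsMatching μ ∧ M.IndRational μ ∧ ∀ f w, ¬ M.Blocks μ f w

/-- `Dom M μ2 μ1` is the partial order `μ2 ⪰ μ1` on stable matchings:
`C_f(μ2(f) ∪ μ1(f)) = μ2(f)` for every firm `f`. -/
def Dom (M : Market F W) (μ2 μ1 : F → Finset W) : Prop :=
  ∀ f, M.Cf f (μ2 f ∪ μ1 f) = μ2 f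

/-- `φ(f)`: the set of stable partners of firm `f`. -/
def phi (M : Market F W) (f : F) : Set W :=
  {w | ∃ μ, M.Stable μ ∧ w ∈ μ f}

/-- `P_f(μ) = {w ∈ φ(f) : w ∈ C_f(μ(f) ∪ {w})}`. -/
def Pf (M : Market F W) (μ : F → Finset W) (f : F) : Set W :=
  {w | w ∈ M.phi f ∧ w ∈ M.Cf f (insert w (μ f))}

/-- The P-set `P(μ) = {(f, w) : f ∈ F, w ∈ P_f(μ)}`. -/
def Pset (M : Market F W) (μ : F → Finset W) : Set (F × W) :=
  {p | p.2 ∈ M.Pf μ p.1}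

/-- All choice functions of the market are path-independent and cardinal monotone
(on their domains). -/
def PathIndepCM (M : Market F W) : Prop :=
  (∀ f, ∀ S ⊆ M.accF f, ∀ T ⊆ M.accF f, M.Cf f (S ∪ T) = M.Cf f (M.Cf f S ∪ T)) ∧
  (∀ f, ∀ S T : Finset W, S ⊆ T → T ⊆ M.accF f → (M.Cf f S).card ≤ (M.Cf f T).card) ∧
  (∀ w, ∀ S ⊆ M.accW w, ∀ T ⊆ M.accW w, M.Cw w (S ∪ T) = M.Cw w (M.Cw w S ∪ T)) ∧
  (∀ w, ∀ S T : Finset F, S ⊆ T → T ⊆ M.accW w → (M.Cw w S).card ≤ (M.Cw w T).card)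

end Market

/-- `μ'` is an immediate predecessor of `μ` in `(S, ⪰)`: `μ' ≻ μ` and no stable `μ''`
lies strictly between them. -/
def Market.ImmPred {F W : Type*} [Fintype F] [Fintype W] [DecidableEq F] [DecidableEq W]
    (M : Market F W) (μ' μ : F → Finset W) : Prop :=
  M.Dom μ' μ ∧ μ' ≠ μ ∧
    ¬ ∃ μ'' : F → Finset W, M.Stable μ'' ∧
        (M.Dom μ' μ'' ∧ μ' ≠ μ'') ∧ (M.Dom μ'' μ ∧ μ'' ≠ μ)

/-- `ρ⁺(μ', μ) := {(f, w) : w ∈ μ(f) \ μ'(f)}`. -/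
def Market.rhoPlus {F W : Type*} [Fintype F] [Fintype W] [DecidableEq F] [DecidableEq W]
    (M : Market F W) (μ' μ : F → Finset W) : Set (F × W) :=
  {p | p.2 ∈ μ p.1 \ μ' p.1}

/-- `ρ⁻(μ', μ) := {(f, w) : w ∈ μ'(f) \ μ(f)}`. -/
def Market.rhoMinus {F W : Type*} [Fintype F] [Fintype W] [DecidableEq F] [DecidableEq W]
    (M : Market F W) (μ' μ : F → Finset W) : Set (F × W) :=
  {p | p.2 ∈ μ' p.1 \ μ p.1}

namespace Market

section ChoiceFunction

variable {α : Type*} [DecidableEq α] {C : Finset α → Finset α} {A S T : Finset α} {a : α}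

/-- Substitutability of path-independent choice functions. -/
theorem choice_substitutable (hC : ∀ S, C S ⊆ S)
    (hPI : ∀ S ⊆ A, ∀ T ⊆ A, C (S ∪ T) = C (C S ∪ T))
    (hST : S ⊆ T) (hT : T ⊆ A) (ha : a ∈ S) (haT : a ∈ C T) : a ∈ C S := by
  have key := hPI S (hST.trans hT) (T \ S) (Finset.sdiff_subset.trans hT)
  rw [Finset.union_sdiff_of_subset hST] at key
  rw [key] at haT
  have := hC _ haT
  simp only [Finset.mem_union, Finset.mem_sdiff] at this
  tauto

/-- Consistency (irrelevance of rejected alternatives) of path-independent choice functions. -/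
theorem choice_consistent (hPI : ∀ S ⊆ A, ∀ T ⊆ A, C (S ∪ T) = C (C S ∪ T))
    (hS : C T ⊆ S) (hST : S ⊆ T) (hT : T ⊆ A) : C S = C T := by
  have key := hPI T hT S (hST.trans hT)
  rw [Finset.union_eq_left.2 hST, Finset.union_eq_right.2 hS] at key
  exact key.symm

end ChoiceFunction

variable {F W : Type*} [Fintype F] [Fintype W] [DecidableEq F] [DecidableEq W]
  {M : Market F W} {μ ν : F → Finset W} {f : F} {w : W}

theorem mem_mw : f ∈ M.mw μ w ↔ w ∈ μ f := by simp [mw]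

/-- The market with the roles of firms and workers exchanged. -/
def swap (M : Market F W) : Market W F where
  accF := M.accW
  accW := M.accF
  compat w f := (M.compat f w).symm
  Cf := M.Cw
  Cw := M.Cf
  CfSub := M.CwSub
  CwSub := M.CfSub

theorem swap_mw_mw : M.swap.mw (M.mw μ) = μ := by
  ext f w
  simp [mem_mw]

theorem PathIndepCM.swap (h : M.PathIndepCM) : M.swap.PathIndepCM :=
  ⟨h.2.2.1, h.2.2.2, h.1, h.2.1⟩

theorem Stable.swap (hμ : M.Stable μ) : M.swap.Stable (M.mw μ) := by
  refine ⟨fun w f hf => (M.compat f w).2 (hμ.1 f (mem_mw.1 hf)), ⟨hμ.2.1.2, fun f => ?_⟩,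
    fun w f hb => ?_⟩
  · rw [swap_mw_mw]
    exact hμ.2.1.1 f
  · obtain ⟨hacc, hnot, hw, hf⟩ := hb
    rw [swap_mw_mw] at hf
    exact hμ.2.2 f w ⟨(M.compat f w).1 hacc, fun hm => hnot (mem_mw.2 hm), hf, hw⟩

theorem Stable.mw_subset_accW (hμ : M.Stable μ) : M.mw μ w ⊆ M.accW w := hμ.swap.1 w

theorem Stable.union_subset_accF (hμ : M.Stable μ) (hν : M.Stable ν) :
    μ f ∪ ν f ⊆ M.accF f :=
  Finset.union_subset (hμ.1 f) (hν.1 f)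

theorem PathIndepCM.mem_Cf_of_subset (h : M.PathIndepCM) {S T : Finset W}
    (hT : T ⊆ M.accF f) (hw : w ∈ M.Cf f T) (hST : S ⊆ T) (hwS : w ∈ S) : w ∈ M.Cf f S :=
  choice_substitutable (M.CfSub f) (h.1 f) hST hT hwS hw

theorem PathIndepCM.mem_Cw_of_subset (h : M.PathIndepCM) {S T : Finset F}
    (hT : T ⊆ M.accW w) (hf : f ∈ M.Cw w T) (hST : S ⊆ T) (hfS : f ∈ S) : f ∈ M.Cw w S :=
  h.swap.mem_Cf_of_subset (M := M.swap) hT hf hST hfS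

theorem Stable.notMem_Cw (hμ : M.Stable μ) (hacc : w ∈ M.accF f) (hw : w ∉ μ f)
    (hc : w ∈ M.Cf f (insert w (μ f))) : f ∉ M.Cw w (insert f (M.mw μ w)) :=
  fun hf => hμ.2.2 f w ⟨hacc, hw, hc, hf⟩

/-- Each firm chooses from the union of its two assignments. -/
def join (M : Market F W) (μ ν : F → Finset W) : F → Finset W :=
  fun f => M.Cf f (μ f ∪ ν f)

/-- Each worker chooses from the union of its two assignments. -/
def meet (M : Market F W) (μ ν : F → Finset W) : F → Finset W :=
  M.swap.mw (M.swap.join (M.mw μ) (M.mw ν))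

theorem mem_meet : w ∈ M.meet μ ν f ↔ f ∈ M.Cw w (M.mw μ w ∪ M.mw ν w) :=
  mem_mw (M := M.swap)

theorem mw_meet : M.mw (M.meet μ ν) = M.swap.join (M.mw μ) (M.mw ν) :=
  swap_mw_mw (M := M.swap)

theorem swap_meet : M.swap.meet (M.mw μ) (M.mw ν) = M.mw (M.join μ ν) := by
  ext w f
  rw [mem_meet, mem_mw, swap_mw_mw, swap_mw_mw]
  rfl

theorem join_comm : M.join μ ν = M.join ν μ := by
  funext f
  simp only [join, Finset.union_comm]

theorem mem_or_mem_of_mem_join (hw : w ∈ M.join μ ν f) : w ∈ μ f ∨ w ∈ ν f :=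
  Finset.mem_union.1 (M.CfSub f _ hw)

theorem mem_or_mem_of_mem_meet (hw : w ∈ M.meet μ ν f) : w ∈ μ f ∨ w ∈ ν f := by
  have := M.CwSub w _ (mem_meet.1 hw)
  simpa [mem_mw] using this

theorem mem_right_of_mem_join_of_mem_meet (h : M.PathIndepCM) (hμ : M.Stable μ)
    (hν : M.Stable ν) (hj : w ∈ M.join μ ν f) (hm : w ∈ M.meet μ ν f) : w ∈ ν f := by
  by_contra hw
  have hwμ : w ∈ μ f := (mem_or_mem_of_mem_join hj).resolve_right hw
  refine hν.notMem_Cw (hμ.1 f hwμ) hw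
    (h.mem_Cf_of_subset (hμ.union_subset_accF hν) hj ?_ (Finset.mem_insert_self _ _))
    (h.mem_Cw_of_subset (hμ.swap.union_subset_accF hν.swap) (mem_meet.1 hm) ?_
      (Finset.mem_insert_self _ _))
  · exact Finset.insert_subset (Finset.mem_union_left _ hwμ) Finset.subset_union_right
  · exact Finset.insert_subset (Finset.mem_union_left _ (mem_mw.2 hwμ))
      Finset.subset_union_right

theorem meet_comm : M.meet μ ν = M.meet ν μ := by
  rw [meet, join_comm, meet]

theorem sum_card_mw (M : Market F W) (μ : F → Finset W) : ∑ w, (M.mw μ w).card = ∑ f, (μ f).card := by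
  have := Finset.sum_card_bipartiteAbove_eq_sum_card_bipartiteBelow
    (s := (Finset.univ : Finset F)) (t := (Finset.univ : Finset W)) (fun f w => w ∈ μ f)
  simpa [Finset.bipartiteAbove, Finset.bipartiteBelow, mw] using this.symm

theorem card_le_card_join (h : M.PathIndepCM) (hμ : M.Stable μ) (hν : M.Stable ν) (f : F) :
    (μ f).card ≤ (M.join μ ν f).card := by
  have := h.2.1 f (μ f) (μ f ∪ ν f) Finset.subset_union_left (hμ.union_subset_accF hν)
  rwa [hμ.2.1.1 f] at this

theorem sum_card_le_sum_card_meet (h : M.PathIndepCM) (hμ : M.Stable μ) (hν : M.Stable ν) :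
    ∑ f, (μ f).card ≤ ∑ f, (M.meet μ ν f).card := by
  rw [← sum_card_mw M μ, ← sum_card_mw M (M.meet μ ν), mw_meet]
  exact Finset.sum_le_sum fun w _ => card_le_card_join h.swap hμ.swap hν.swap w

/-- The join and the meet split the two assignments as multisets, and every firm has the same
number of partners in all of them. -/
theorem join_meet_modular (h : M.PathIndepCM) (hμ : M.Stable μ) (hν : M.Stable ν) (f : F) :
    M.join μ ν f ∪ M.meet μ ν f = μ f ∪ ν f ∧ M.join μ ν f ∩ M.meet μ ν f = μ f ∩ ν f ∧
      (μ f).card = (M.join μ ν f).card := by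
  have hunion : ∀ f, M.join μ ν f ∪ M.meet μ ν f ⊆ μ f ∪ ν f := fun f w hw =>
    Finset.mem_union.2
      ((Finset.mem_union.1 hw).elim mem_or_mem_of_mem_join mem_or_mem_of_mem_meet)
  have hinter : ∀ f, M.join μ ν f ∩ M.meet μ ν f ⊆ μ f ∩ ν f := fun f w hw => by
    obtain ⟨hj, hm⟩ := Finset.mem_inter.1 hw
    have hwν := mem_right_of_mem_join_of_mem_meet h hμ hν hj hm
    rw [join_comm] at hj
    rw [meet_comm] at hm
    exact Finset.mem_inter.2 ⟨mem_right_of_mem_join_of_mem_meet h hν hμ hj hm, hwν⟩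
  have hle : ∀ f, (M.join μ ν f).card + (M.meet μ ν f).card ≤ (μ f).card + (ν f).card := by
    intro f
    rw [← Finset.card_union_add_card_inter (M.join μ ν f),
      ← Finset.card_union_add_card_inter (μ f)]
    exact add_le_add (Finset.card_le_card (hunion f)) (Finset.card_le_card (hinter f))
  have hsum := Finset.sum_le_sum fun f (_ : f ∈ Finset.univ) => hle f
  have hj1 := Finset.sum_le_sum fun f (_ : f ∈ Finset.univ) => card_le_card_join h hμ hν f
  have hj2 := Finset.sum_le_sum fun f (_ : f ∈ Finset.univ) => card_le_card_join h hν hμ f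
  have hm1 := sum_card_le_sum_card_meet h hμ hν
  have hm2 := sum_card_le_sum_card_meet h hν hμ
  rw [join_comm] at hj2
  rw [meet_comm] at hm2
  simp only [Finset.sum_add_distrib] at hsum
  have hcard : (μ f).card = (M.join μ ν f).card :=
    (Finset.sum_eq_sum_iff_of_le fun f _ => card_le_card_join h hμ hν f).1 (by omega) f
      (Finset.mem_univ f)
  have htot : (M.join μ ν f).card + (M.meet μ ν f).card = (μ f).card + (ν f).card :=
    (Finset.sum_eq_sum_iff_of_le fun f _ => hle f).1
      (by simp only [Finset.sum_add_distrib]; omega) f (Finset.mem_univ f)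
  rw [← Finset.card_union_add_card_inter (M.join μ ν f),
      ← Finset.card_union_add_card_inter (μ f)] at htot
  have hu := Finset.card_le_card (hunion f)
  have hi := Finset.card_le_card (hinter f)
  exact ⟨Finset.eq_of_subset_of_card_le (hunion f) (by omega),
    Finset.eq_of_subset_of_card_le (hinter f) (by omega), hcard⟩

theorem mem_join_or_mem_meet_iff (h : M.PathIndepCM) (hμ : M.Stable μ) (hν : M.Stable ν) :
    w ∈ M.join μ ν f ∨ w ∈ M.meet μ ν f ↔ w ∈ μ f ∨ w ∈ ν f := by
  rw [← Finset.mem_union, (join_meet_modular h hμ hν f).1, Finset.mem_union]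

theorem mem_join_and_mem_meet_iff (h : M.PathIndepCM) (hμ : M.Stable μ) (hν : M.Stable ν) :
    w ∈ M.join μ ν f ∧ w ∈ M.meet μ ν f ↔ w ∈ μ f ∧ w ∈ ν f := by
  rw [← Finset.mem_inter, (join_meet_modular h hμ hν f).2.1, Finset.mem_inter]

theorem card_join (h : M.PathIndepCM) (hμ : M.Stable μ) (hν : M.Stable ν) (f : F) :
    (M.join μ ν f).card = (μ f).card :=
  (join_meet_modular h hμ hν f).2.2.symm

/-- All stable matchings give a firm the same number of partners. -/
theorem Stable.card_eq (h : M.PathIndepCM) (hμ : M.Stable μ) (hν : M.Stable ν) (f : F) :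
    (μ f).card = (ν f).card := by
  rw [← card_join h hμ hν, join_comm, card_join h hν hμ]

theorem card_meet (h : M.PathIndepCM) (hμ : M.Stable μ) (hν : M.Stable ν) (f : F) :
    (M.meet μ ν f).card = (μ f).card := by
  have hmod := join_meet_modular h hμ hν f
  have e1 := Finset.card_union_add_card_inter (M.join μ ν f) (M.meet μ ν f)
  have e2 := Finset.card_union_add_card_inter (μ f) (ν f)
  rw [hmod.1, hmod.2.1] at e1
  have := card_join h hμ hν f
  have := hμ.card_eq h hν f
  omega

theorem join_subset_accF (hμ : M.Stable μ) (hν : M.Stable ν) : M.join μ ν f ⊆ M.accF f :=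
  (M.CfSub f _).trans (hμ.union_subset_accF hν)

theorem union_mw_join_subset_accW (hμ : M.Stable μ) (hν : M.Stable ν) :
    M.mw μ w ∪ M.mw (M.join μ ν) w ⊆ M.accW w :=
  Finset.union_subset hμ.mw_subset_accW fun f hf =>
    (M.compat f w).2 (join_subset_accF hμ hν (mem_mw.1 hf))

/-- A worker prefers `μ` to the join of `μ` with another stable matching. -/
theorem Cw_union_join (h : M.PathIndepCM) (hμ : M.Stable μ) (hν : M.Stable ν) (w : W) :
    M.Cw w (M.mw μ w ∪ M.mw (M.join μ ν) w) = M.mw μ w := by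
  have hacc := union_mw_join_subset_accW (w := w) hμ hν
  rw [← choice_consistent (h.2.2.1 w) (S := M.mw μ w) ?_ Finset.subset_union_left hacc]
  · exact hμ.2.1.2 w
  · intro f hf
    by_contra hn
    have hj : f ∈ M.mw (M.join μ ν) w :=
      (Finset.mem_union.1 (M.CwSub w _ hf)).resolve_left hn
    have hj' := mem_mw.1 hj
    have hwμ : w ∉ μ f := fun hw => hn (mem_mw.2 hw)
    refine hμ.notMem_Cw (join_subset_accF hμ hν hj') hwμ
      (h.mem_Cf_of_subset (hμ.union_subset_accF hν) hj' ?_ (Finset.mem_insert_self _ _))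
      (h.mem_Cw_of_subset hacc hf ?_ (Finset.mem_insert_self _ _))
    · exact Finset.insert_subset (M.CfSub f _ hj') Finset.subset_union_left
    · exact Finset.insert_subset (Finset.mem_union_right _ hj) Finset.subset_union_left

/-- A worker who rejects the firm `f` at `μ` also chooses `μ` when offered, in addition, both `f`
and its partners in a join. -/
theorem Cw_union_join_insert (h : M.PathIndepCM) (hμ : M.Stable μ) (hν : M.Stable ν)
    (hacc : w ∈ M.accF f) (hrej : f ∉ M.Cw w (insert f (M.mw μ w))) :
    M.Cw w (M.mw μ w ∪ M.mw (M.join μ ν) w ∪ {f}) = M.mw μ w := by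
  have hf : f ∈ M.accW w := (M.compat f w).2 hacc
  have hbase : M.Cw w (insert f (M.mw μ w)) = M.mw μ w := by
    rw [← choice_consistent (h.2.2.1 w) (S := M.mw μ w) ?_ (Finset.subset_insert _ _)
      (Finset.insert_subset hf hμ.mw_subset_accW)]
    · exact hμ.2.1.2 w
    · intro x hx
      rcases Finset.mem_insert.1 (M.CwSub w _ hx) with rfl | hx'
      · exact absurd hx hrej
      · exact hx'
  rw [h.2.2.1 w _ (union_mw_join_subset_accW hμ hν) _ (Finset.singleton_subset_iff.2 hf),
    Cw_union_join h hμ hν, Finset.union_comm, ← Finset.insert_eq, hbase]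

theorem stable_join (h : M.PathIndepCM) (hμ : M.Stable μ) (hν : M.Stable ν) :
    M.Stable (M.join μ ν) := by
  refine ⟨fun f => join_subset_accF hμ hν, ⟨fun f => ?_, fun w => ?_⟩, ?_⟩
  · exact choice_consistent (h.1 f) subset_rfl (M.CfSub f _) (hμ.union_subset_accF hν)
  · refine (M.CwSub w _).antisymm fun f hf => ?_
    have key : ∀ {μ ν : F → Finset W}, M.Stable μ → M.Stable ν → w ∈ μ f →
        f ∈ M.mw (M.join μ ν) w → f ∈ M.Cw w (M.mw (M.join μ ν) w) := by
      intro μ ν hμ hν hw hf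
      refine h.mem_Cw_of_subset (union_mw_join_subset_accW hμ hν) ?_
        Finset.subset_union_right hf
      rw [Cw_union_join h hμ hν]
      exact mem_mw.2 hw
    rcases mem_or_mem_of_mem_join (mem_mw.1 hf) with hw | hw
    · exact key hμ hν hw hf
    · rw [join_comm] at hf ⊢
      exact key hν hμ hw hf
  · rintro g w ⟨hacc, hnot, hw, hg⟩
    have hgacc : {w} ⊆ M.accF g := Finset.singleton_subset_iff.2 hacc
    have hUacc := hμ.union_subset_accF (f := g) hν
    have hU : w ∈ M.Cf g (μ g ∪ ν g ∪ {w}) := by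
      rw [h.1 g _ hUacc _ hgacc, Finset.union_comm, ← Finset.insert_eq]
      exact hw
    have hbigacc := Finset.union_subset hUacc hgacc
    have hwU : w ∉ μ g ∪ ν g := fun hm => hnot
      (h.mem_Cf_of_subset hbigacc hU Finset.subset_union_left hm)
    rw [Finset.mem_union, not_or] at hwU
    have hrejμ := hμ.notMem_Cw hacc hwU.1 (h.mem_Cf_of_subset hbigacc hU
      (by intro x; simp only [Finset.mem_insert, Finset.mem_union, Finset.mem_singleton]; tauto)
      (Finset.mem_insert_self _ _))
    have hrejν := hν.notMem_Cw hacc hwU.2 (h.mem_Cf_of_subset hbigacc hU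
      (by intro x; simp only [Finset.mem_insert, Finset.mem_union, Finset.mem_singleton]; tauto)
      (Finset.mem_insert_self _ _))
    have key : ∀ {μ ν : F → Finset W}, M.Stable μ → M.Stable ν →
        g ∉ M.Cw w (insert g (M.mw μ w)) →
        (∀ f, w ∈ μ f → w ∈ M.join μ ν f → f ∈ M.Cw w (insert g (M.mw (M.join μ ν) w))) ∧
          (M.Cw w (insert g (M.mw (M.join μ ν) w))).card ≤ (M.mw μ w).card := by
      intro μ ν hμ hν hrej
      have hsub : insert g (M.mw (M.join μ ν) w) ⊆ M.mw μ w ∪ M.mw (M.join μ ν) w ∪ {g} := by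
        intro x
        simp only [Finset.mem_insert, Finset.mem_union, Finset.mem_singleton]
        tauto
      have hsubacc := Finset.union_subset (union_mw_join_subset_accW (w := w) hμ hν)
        (Finset.singleton_subset_iff.2 ((M.compat g w).2 hacc))
      have hbig := Cw_union_join_insert h hμ hν hacc hrej
      refine ⟨fun f hfμ hfj => h.mem_Cw_of_subset hsubacc
        (hbig.symm.subset (mem_mw.2 hfμ)) hsub
        (Finset.mem_insert_of_mem (mem_mw.2 hfj)), ?_⟩
      have := h.2.2.2 w _ _ hsub hsubacc
      rwa [hbig] at this
    obtain ⟨hμmem, hcard⟩ := key hμ hν hrejμ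
    obtain ⟨hνmem, -⟩ := key hν hμ hrejν
    rw [join_comm] at hνmem
    have hall : insert g (M.mw (M.join μ ν) w) ⊆ M.Cw w (insert g (M.mw (M.join μ ν) w)) := by
      refine Finset.insert_subset hg fun f hf => ?_
      rw [mem_mw] at hf
      exact (mem_or_mem_of_mem_join hf).elim (fun hw => hμmem f hw hf) fun hw => hνmem f hw hf
    have hle := Finset.card_le_card hall
    rw [Finset.card_insert_of_notMem (fun hm => hnot (mem_mw.1 hm)), ← swap_meet] at hle
    have := card_meet h.swap hμ.swap hν.swap w
    rw [← swap_meet] at hcard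
    omega

theorem stable_meet (h : M.PathIndepCM) (hμ : M.Stable μ) (hν : M.Stable ν) :
    M.Stable (M.meet μ ν) :=
  (stable_join h.swap hμ.swap hν.swap).swap (M := M.swap)

theorem Cf_union_meet (h : M.PathIndepCM) (hμ : M.Stable μ) (hν : M.Stable ν) (f : F) :
    M.Cf f (μ f ∪ M.meet μ ν f) = μ f := by
  have := Cw_union_join h.swap hμ.swap hν.swap f
  rwa [swap_mw_mw] at this

theorem mem_accF_of_mem_phi (hw : w ∈ M.phi f) : w ∈ M.accF f := by
  obtain ⟨lam, hlam, hw⟩ := hw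
  exact hlam.1 f hw

theorem mem_phi_swap : f ∈ M.swap.phi w ↔ w ∈ M.phi f := by
  constructor
  · rintro ⟨lam, hlam, hf⟩
    exact ⟨M.swap.mw lam, hlam.swap (M := M.swap), mem_mw.2 hf⟩
  · rintro ⟨lam, hlam, hw⟩
    exact ⟨M.mw lam, hlam.swap, mem_mw.2 hw⟩

theorem Stable.mem_Pf (hμ : M.Stable μ) (hw : w ∈ μ f) : w ∈ M.Pf μ f :=
  ⟨⟨μ, hμ, hw⟩, by rwa [Finset.insert_eq_of_mem hw, hμ.2.1.1 f]⟩

/-- A stable partner that the firm wants at `μ` stays in the join of `μ` with any stable matching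
containing the pair. -/
theorem mem_join_of_mem_Pf (h : M.PathIndepCM) (hμ : M.Stable μ) (hν : M.Stable ν)
    (hw : w ∈ M.Pf μ f) (hwν : w ∈ ν f) : w ∈ M.join μ ν f := by
  by_cases hwμ : w ∈ μ f
  · exact ((mem_join_and_mem_meet_iff h hμ hν).2 ⟨hwμ, hwν⟩).1
  · refine ((mem_join_or_mem_meet_iff h hμ hν).2 (Or.inr hwν)).resolve_right fun hm => ?_
    refine hμ.notMem_Cw (hν.1 f hwν) hwμ hw.2 (h.mem_Cw_of_subset
      (hμ.swap.union_subset_accF hν.swap) (mem_meet.1 hm) ?_ (Finset.mem_insert_self _ _))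
    exact Finset.insert_subset (Finset.mem_union_right _ (mem_mw.2 hwν))
      Finset.subset_union_left

theorem Cf_insert_join (h : M.PathIndepCM) (hμ : M.Stable μ) (hν : M.Stable ν)
    (hw : w ∈ M.accF f) :
    M.Cf f (insert w (M.join μ ν f)) = M.Cf f (insert w (μ f ∪ ν f)) := by
  have := h.1 f (μ f ∪ ν f) (hμ.union_subset_accF hν) {w} (Finset.singleton_subset_iff.2 hw)
  rw [Finset.insert_eq, Finset.insert_eq, Finset.union_comm, Finset.union_comm {w}]
  exact this.symm

theorem mem_Pf_of_mem_Cf_insert_union (h : M.PathIndepCM) (hμ : M.Stable μ) (hν : M.Stable ν)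
    (hphi : w ∈ M.phi f) (hw : w ∈ M.Cf f (insert w (μ f ∪ ν f))) : w ∈ M.Pf μ f :=
  ⟨hphi, h.mem_Cf_of_subset
    (Finset.insert_subset (mem_accF_of_mem_phi hphi) (hμ.union_subset_accF hν)) hw
    (Finset.insert_subset_insert _ Finset.subset_union_left) (Finset.mem_insert_self _ _)⟩

theorem mem_Pf_join (h : M.PathIndepCM) (hμ : M.Stable μ) (hν : M.Stable ν) :
    w ∈ M.Pf (M.join μ ν) f ↔ w ∈ M.Pf μ f ∧ w ∈ M.Pf ν f := by
  constructor
  · rintro ⟨hphi, hw⟩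
    rw [Cf_insert_join h hμ hν (mem_accF_of_mem_phi hphi)] at hw
    refine ⟨mem_Pf_of_mem_Cf_insert_union h hμ hν hphi hw,
      mem_Pf_of_mem_Cf_insert_union h hν hμ hphi ?_⟩
    rwa [Finset.union_comm]
  · rintro ⟨hwμ, hwν⟩
    obtain ⟨lam, hlam, hwlam⟩ := hwμ.1
    have hμl := stable_join h hμ hlam
    have hνl := stable_join h hν hlam
    have hjoin := ((mem_join_and_mem_meet_iff h hμl hνl).2
      ⟨mem_join_of_mem_Pf h hμ hlam hwμ hwlam, mem_join_of_mem_Pf h hν hlam hwν hwlam⟩).1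
    refine ⟨hwμ.1, ?_⟩
    rw [Cf_insert_join h hμ hν (mem_accF_of_mem_phi hwμ.1)]
    have hbig : w ∈ M.Cf f (μ f ∪ lam f ∪ (ν f ∪ lam f)) := by
      rw [h.1 f _ (hμ.union_subset_accF hlam) _ (hν.union_subset_accF hlam), Finset.union_comm,
        h.1 f _ (hν.union_subset_accF hlam) _ ((M.CfSub f _).trans (hμ.union_subset_accF hlam)),
        Finset.union_comm]
      exact hjoin
    refine h.mem_Cf_of_subset (Finset.union_subset (hμ.union_subset_accF hlam)
      (hν.union_subset_accF hlam)) hbig ?_ (Finset.mem_insert_self _ _)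
    refine Finset.insert_subset (Finset.mem_union_left _ (Finset.mem_union_right _ hwlam)) ?_
    exact Finset.union_subset_union Finset.subset_union_left Finset.subset_union_left

/-- A stable partner not wanted by the firm wants the firm. -/
theorem mem_Pf_swap_of_notMem (h : M.PathIndepCM) (hμ : M.Stable μ) (hphi : w ∈ M.phi f)
    (hw : w ∉ M.Pf μ f) : f ∈ M.swap.Pf (M.mw μ) w := by
  obtain ⟨lam, hlam, hwlam⟩ := id hphi
  have hj : w ∉ M.join μ lam f := fun hj => hw ⟨hphi, h.mem_Cf_of_subset
    (hμ.union_subset_accF hlam) hj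
    (Finset.insert_subset (Finset.mem_union_right _ hwlam) Finset.subset_union_left)
    (Finset.mem_insert_self _ _)⟩
  have hm := ((mem_join_or_mem_meet_iff h hμ hlam).2 (Or.inr hwlam)).resolve_left hj
  exact ⟨mem_phi_swap.2 hphi, h.mem_Cw_of_subset (hμ.swap.union_subset_accF hlam.swap)
    (mem_meet.1 hm) (Finset.insert_subset (Finset.mem_union_right _ (mem_mw.2 hwlam))
      Finset.subset_union_left) (Finset.mem_insert_self _ _)⟩

theorem Dom.mem_Pf (h : M.PathIndepCM) (hμ : M.Stable μ) (hν : M.Stable ν)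
    (hdom : M.Dom μ ν) (hw : w ∈ M.Pf μ f) : w ∈ M.Pf ν f := by
  refine mem_Pf_of_mem_Cf_insert_union h hν hμ hw.1 ?_
  rw [Finset.union_comm, ← Cf_insert_join h hμ hν (mem_accF_of_mem_phi hw.1), join, hdom f]
  exact hw.2

theorem mem_Pf_meet (h : M.PathIndepCM) (hμ : M.Stable μ) (hν : M.Stable ν) :
    w ∈ M.Pf (M.meet μ ν) f ↔ w ∈ M.Pf μ f ∨ w ∈ M.Pf ν f := by
  have hm := stable_meet h hμ hν
  constructor
  · intro hw
    by_contra! hn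
    have hswap := (mem_Pf_join h.swap hμ.swap hν.swap).2
      ⟨mem_Pf_swap_of_notMem h hμ hw.1 hn.1, mem_Pf_swap_of_notMem h hν hw.1 hn.2⟩
    rw [← mw_meet] at hswap
    refine hm.notMem_Cw (mem_accF_of_mem_phi hw.1) (fun hmem => ?_) hw.2 hswap.2
    exact (mem_or_mem_of_mem_meet hmem).elim (fun hw => hn.1 (hμ.mem_Pf hw))
      fun hw => hn.2 (hν.mem_Pf hw)
  · rintro (hw | hw)
    · exact Dom.mem_Pf h hμ hm (Cf_union_meet h hμ hν) hw
    · refine Dom.mem_Pf h hν hm (fun f => ?_) hw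
      rw [meet_comm]
      exact Cf_union_meet h hν hμ f

theorem Pset_join (h : M.PathIndepCM) (hμ : M.Stable μ) (hν : M.Stable ν) :
    M.Pset (M.join μ ν) = M.Pset μ ∩ M.Pset ν :=
  Set.ext fun _ => mem_Pf_join h hμ hν

theorem Pset_meet (h : M.PathIndepCM) (hμ : M.Stable μ) (hν : M.Stable ν) :
    M.Pset (M.meet μ ν) = M.Pset μ ∪ M.Pset ν :=
  Set.ext fun _ => mem_Pf_meet h hμ hν

theorem Dom.Pset_subset (h : M.PathIndepCM) (hμ : M.Stable μ) (hν : M.Stable ν)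
    (hdom : M.Dom μ ν) : M.Pset μ ⊆ M.Pset ν :=
  fun _ hp => Dom.mem_Pf h hμ hν hdom hp

theorem dom_of_Pset_subset (h : M.PathIndepCM) (hμ : M.Stable μ) (hν : M.Stable ν)
    (hP : M.Pset μ ⊆ M.Pset ν) : M.Dom μ ν := by
  intro f
  refine (Finset.eq_of_subset_of_card_le (fun w hw => ?_) (card_join h hμ hν f).le).symm
  have hwν : (f, w) ∈ M.Pset ν := hP (show (f, w) ∈ M.Pset μ from hμ.mem_Pf hw)
  rw [join_comm]
  exact mem_join_of_mem_Pf h hν hμ hwν hw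

theorem eq_of_Pset_eq (h : M.PathIndepCM) (hμ : M.Stable μ) (hν : M.Stable ν)
    (hP : M.Pset μ = M.Pset ν) : μ = ν := by
  funext f
  rw [← dom_of_Pset_subset h hμ hν hP.subset f, Finset.union_comm,
    dom_of_Pset_subset h hν hμ hP.symm.subset f]

variable {μ1 μ1' μ2 μ2' : F → Finset W}

theorem ImmPred.Pset_eq_or_eq (h : M.PathIndepCM) {lam : F → Finset W} (himm : M.ImmPred μ ν)
    (hμ : M.Stable μ) (hν : M.Stable ν) (hlam : M.Stable lam)
    (h1 : M.Pset μ ⊆ M.Pset lam) (h2 : M.Pset lam ⊆ M.Pset ν) :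
    M.Pset lam = M.Pset μ ∨ M.Pset lam = M.Pset ν := by
  by_contra! hne
  exact himm.2.2 ⟨lam, hlam,
    ⟨dom_of_Pset_subset h hμ hlam h1, fun he => hne.1 (he ▸ rfl)⟩,
    ⟨dom_of_Pset_subset h hlam hν h2, fun he => hne.2 (he ▸ rfl)⟩⟩

/-- Minimal differences of P-sets that meet are nested (hence equal). -/
theorem ImmPred.Pset_sdiff_subset (h : M.PathIndepCM)
    (h1 : M.Stable μ1) (h1' : M.Stable μ1') (h2 : M.Stable μ2) (h2' : M.Stable μ2')
    (himm : M.ImmPred μ1' μ1) {p : F × W}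
    (hp1 : p ∈ M.Pset μ1 \ M.Pset μ1') (hp2 : p ∈ M.Pset μ2 \ M.Pset μ2') :
    M.Pset μ1 \ M.Pset μ1' ⊆ M.Pset μ2 \ M.Pset μ2' := by
  have hsub := Dom.Pset_subset h h1' h1 himm.1
  have hP : ∀ {lam : F → Finset W}, M.Stable lam →
      M.Pset μ1' ∪ M.Pset μ1 ∩ M.Pset lam = M.Pset μ1' ∨
        M.Pset μ1' ∪ M.Pset μ1 ∩ M.Pset lam = M.Pset μ1 := by
    intro lam hlam
    have hj := stable_join h h1 hlam
    have hm := stable_meet h h1' hj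
    have := himm.Pset_eq_or_eq h h1' h1 hm
    rw [Pset_meet h h1' hj, Pset_join h h1 hlam] at this
    exact this Set.subset_union_left (Set.union_subset hsub Set.inter_subset_left)
  intro q hq
  constructor
  · have hor := (hP h2).resolve_left fun he => hp1.2 (he.subset (Or.inr ⟨hp1.1, hp2.1⟩))
    exact ((hor.symm.subset hq.1).resolve_left hq.2).2
  · intro hq2
    have hor := (hP h2').resolve_right fun he =>
      (he.symm.subset hp1.1).elim hp1.2 fun hp => hp2.2 hp.2
    exact hq.2 (hor.subset (Or.inr ⟨hq.1, hq2⟩))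

theorem rhoPlus_subset_Pset_sdiff (h : M.PathIndepCM) (hμ : M.Stable μ) (hν : M.Stable ν)
    (hdom : M.Dom μ ν) : M.rhoPlus μ ν ⊆ M.Pset ν \ M.Pset μ := by
  rintro ⟨f, w⟩ hp
  obtain ⟨hwν, hwμ⟩ := Finset.mem_sdiff.1 (show w ∈ ν f \ μ f from hp)
  refine ⟨hν.mem_Pf hwν, fun hP => hwμ ?_⟩
  have := mem_join_of_mem_Pf h hμ hν hP hwν
  rwa [join, hdom f] at this

theorem ImmPred.rhoPlus_nonempty (h : M.PathIndepCM) (hμ : M.Stable μ) (hν : M.Stable ν)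
    (himm : M.ImmPred μ ν) : (M.rhoPlus μ ν).Nonempty := by
  by_contra hempty
  refine himm.2.1 (funext fun f => ?_)
  refine (Finset.eq_of_subset_of_card_le (fun w hw => ?_) (hμ.card_eq h hν f).le).symm
  by_contra hn
  exact hempty ⟨(f, w), Finset.mem_sdiff.2 ⟨hw, hn⟩⟩

/-- The exchange between two comparable stable matchings is the one between their joins with a
matching realising the same difference of P-sets. -/
theorem mem_sdiff_iff_of_Pset_sdiff_eq (h : M.PathIndepCM)
    (h1 : M.Stable μ1) (h1' : M.Stable μ1') (h2 : M.Stable μ2) (h2' : M.Stable μ2')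
    (hdom1 : M.Dom μ1' μ1) (hdom2 : M.Dom μ2' μ2)
    (heq : M.Pset μ1 \ M.Pset μ1' = M.Pset μ2 \ M.Pset μ2') (f : F) (w : W) :
    (w ∈ μ1 f \ μ1' f ↔ w ∈ M.join μ1 μ2 f \ M.join μ1' μ2' f) ∧
      (w ∈ μ1' f \ μ1 f ↔ w ∈ M.join μ1' μ2' f \ M.join μ1 μ2 f) := by
  have hj := stable_join h h1 h2
  have hj' := stable_join h h1' h2'
  have hs1 := Dom.Pset_subset h h1' h1 hdom1
  have hs2 := Dom.Pset_subset h h2' h2 hdom2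
  have hmeet : M.meet (M.join μ1 μ2) μ1' = μ1 := by
    refine eq_of_Pset_eq h (stable_meet h hj h1') h1 ?_
    rw [Pset_meet h hj h1', Pset_join h h1 h2]
    ext p
    have := Set.ext_iff.1 heq p
    have := @hs1 p
    simp only [Set.mem_union, Set.mem_inter_iff, Set.mem_sdiff] at *
    tauto
  have hjoin : M.join (M.join μ1 μ2) μ1' = M.join μ1' μ2' := by
    refine eq_of_Pset_eq h (stable_join h hj h1') hj' ?_
    rw [Pset_join h hj h1', Pset_join h h1 h2, Pset_join h h1' h2']
    ext p
    have := Set.ext_iff.1 heq p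
    have := @hs1 p
    have := @hs2 p
    simp only [Set.mem_inter_iff, Set.mem_sdiff] at *
    tauto
  have hor := mem_join_or_mem_meet_iff (f := f) (w := w) h hj h1'
  have hand := mem_join_and_mem_meet_iff (f := f) (w := w) h hj h1'
  rw [hmeet, hjoin] at hor hand
  simp only [Finset.mem_sdiff]
  tauto

end Market


/-- In a matching market in which all choice functions are
path-independent and cardinal monotone, let `μ1', μ2'` be immediate predecessors of the
stable matchings `μ1, μ2` respectively. Then `P(μ1) \ P(μ1') = P(μ2) \ P(μ2')` iff
`ρ(μ1', μ1) = ρ(μ2', μ2)`, i.e. `ρ⁺(μ1', μ1) = ρ⁺(μ2', μ2)` and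
`ρ⁻(μ1', μ1) = ρ⁻(μ2', μ2)`. -/
theorem stmt_16 {F W : Type*} [Fintype F] [Fintype W] [DecidableEq F] [DecidableEq W]
    (M : Market F W) (h : M.PathIndepCM)
    (μ1 μ1' μ2 μ2' : F → Finset W)
    (h1 : M.Stable μ1) (h1' : M.Stable μ1') (h2 : M.Stable μ2) (h2' : M.Stable μ2')
    (himm1 : M.ImmPred μ1' μ1) (himm2 : M.ImmPred μ2' μ2) :
    M.Pset μ1 \ M.Pset μ1' = M.Pset μ2 \ M.Pset μ2' ↔
      (M.rhoPlus μ1' μ1 = M.rhoPlus μ2' μ2 ∧ M.rhoMinus μ1' μ1 = M.rhoMinus μ2' μ2) := by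
  constructor
  · intro heq
    have e1 := Market.mem_sdiff_iff_of_Pset_sdiff_eq h h1 h1' h2 h2' himm1.1 himm2.1 heq
    have e2 := Market.mem_sdiff_iff_of_Pset_sdiff_eq h h2 h2' h1 h1' himm2.1 himm1.1 heq.symm
    rw [Market.join_comm (μ := μ2), Market.join_comm (μ := μ2')] at e2
    exact ⟨Set.ext fun p => (e1 p.1 p.2).1.trans (e2 p.1 p.2).1.symm,
      Set.ext fun p => (e1 p.1 p.2).2.trans (e2 p.1 p.2).2.symm⟩
  · rintro ⟨hplus, -⟩
    obtain ⟨p, hp⟩ := himm1.rhoPlus_nonempty h h1' h1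
    have hp1 := Market.rhoPlus_subset_Pset_sdiff h h1' h1 himm1.1 hp
    have hp2 := Market.rhoPlus_subset_Pset_sdiff h h2' h2 himm2.1 (hplus ▸ hp)
    exact (himm1.Pset_sdiff_subset h h1 h1' h2 h2' hp1 hp2).antisymm
      (himm2.Pset_sdiff_subset h h2 h2' h1 h1' hp2 hp1)
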